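/- Let G be a subgroup of Σ₃ and let M be an R-module with an R-bilinear multiplication that is G-associative, i.e. Σ_{σ ∈ G} (−1)^{ε(σ)} A(x_{σ⁻¹(1)}, x_{σ⁻¹(2)}, x_{σ⁻¹(3)}) = 0 for all x₁, x₂, x₃ ∈ M, where A(x,y,z) = (xy)z − x(yz). Then the multiplication is Lie-admissible: Σ_{σ ∈ Σ₃} (−1)^{ε(σ)} A(x_{σ⁻¹(1)}, x_{σ⁻¹(2)}, x_{σ⁻¹(3)}) = 0 for all x₁, x₂, x₃ ∈ M; equivalently, the commutator [x, y] = xy − yx satisfies the Jacobi identity. -/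

import Mathlib

/-- A sum over a finite group vanishes if it vanishes on every right coset of a subgroup. -/
theorem sum_eq_zero_of_cosets {H M : Type*} [Group H] [Fintype H] [AddCommMonoid M]
    (G : Subgroup H) [Fintype G] (F : H → M)
    (h : ∀ τ : H, ∑ g : G, F ((g : H) * τ) = 0) : ∑ σ : H, F σ = 0 := by
  classical
  obtain ⟨T, hT, -⟩ := G.exists_isComplement_right 1
  have := Fintype.ofFinite T
  rw [← Function.Bijective.sum_comp hT F, Fintype.sum_prod_type_right]
  exact Finset.sum_eq_zero fun t _ => h t

/-- Every `G`-associative algebra, for `G` a subgroup of `Σ₃`, is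
Lie-admissible: the full alternating sum of associators over `Σ₃` vanishes; equivalently,
the commutator bracket `[x, y] = xy − yx` satisfies the Jacobi identity. -/
theorem G_associative_lieAdmissible {R M : Type*} [CommRing R] [AddCommGroup M] [Module R M]
    (G : Subgroup (Equiv.Perm (Fin 3))) [DecidablePred (· ∈ G)]
    (m : M →ₗ[R] M →ₗ[R] M)
    (hm : ∀ x₁ x₂ x₃ : M, ∑ σ : G, (Equiv.Perm.sign (σ : Equiv.Perm (Fin 3)) : ℤ) •
        (m (m (![x₁, x₂, x₃] ((σ : Equiv.Perm (Fin 3))⁻¹ 0))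
              (![x₁, x₂, x₃] ((σ : Equiv.Perm (Fin 3))⁻¹ 1)))
            (![x₁, x₂, x₃] ((σ : Equiv.Perm (Fin 3))⁻¹ 2))
          - m (![x₁, x₂, x₃] ((σ : Equiv.Perm (Fin 3))⁻¹ 0))
            (m (![x₁, x₂, x₃] ((σ : Equiv.Perm (Fin 3))⁻¹ 1))
              (![x₁, x₂, x₃] ((σ : Equiv.Perm (Fin 3))⁻¹ 2)))) = 0) :
    ∀ x₁ x₂ x₃ : M,
      (∑ σ : Equiv.Perm (Fin 3), (Equiv.Perm.sign σ : ℤ) •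
        (m (m (![x₁, x₂, x₃] (σ⁻¹ 0)) (![x₁, x₂, x₃] (σ⁻¹ 1))) (![x₁, x₂, x₃] (σ⁻¹ 2))
          - m (![x₁, x₂, x₃] (σ⁻¹ 0))
            (m (![x₁, x₂, x₃] (σ⁻¹ 1)) (![x₁, x₂, x₃] (σ⁻¹ 2)))) = 0)
      ∧ ((m (m x₁ x₂ - m x₂ x₁) x₃ - m x₃ (m x₁ x₂ - m x₂ x₁))
          + (m (m x₂ x₃ - m x₃ x₂) x₁ - m x₁ (m x₂ x₃ - m x₃ x₂)))
          + (m (m x₃ x₁ - m x₁ x₃) x₂ - m x₂ (m x₃ x₁ - m x₁ x₃)) = 0 := by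
  intro x₁ x₂ x₃
  have h1 : ∑ σ : Equiv.Perm (Fin 3), (Equiv.Perm.sign σ : ℤ) •
        (m (m (![x₁, x₂, x₃] (σ⁻¹ 0)) (![x₁, x₂, x₃] (σ⁻¹ 1))) (![x₁, x₂, x₃] (σ⁻¹ 2))
          - m (![x₁, x₂, x₃] (σ⁻¹ 0))
            (m (![x₁, x₂, x₃] (σ⁻¹ 1)) (![x₁, x₂, x₃] (σ⁻¹ 2)))) = 0 := by
    apply sum_eq_zero_of_cosets G
    intro τ
    have h := hm (![x₁, x₂, x₃] (τ⁻¹ 0)) (![x₁, x₂, x₃] (τ⁻¹ 1)) (![x₁, x₂, x₃] (τ⁻¹ 2))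
    have e : ∀ i, ![![x₁, x₂, x₃] (τ⁻¹ 0), ![x₁, x₂, x₃] (τ⁻¹ 1), ![x₁, x₂, x₃] (τ⁻¹ 2)] i
        = ![x₁, x₂, x₃] (τ⁻¹ i) := by
      intro i
      fin_cases i <;> rfl
    simp only [e] at h
    have h' := congrArg (fun z => (Equiv.Perm.sign τ : ℤ) • z) h
    simp only [Finset.smul_sum, smul_zero, smul_smul] at h'
    simpa only [mul_inv_rev, Equiv.Perm.mul_apply, Equiv.Perm.sign_mul, Units.val_mul,
      mul_comm] using h'
  refine ⟨h1, ?_⟩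
  have hu : (Finset.univ : Finset (Equiv.Perm (Fin 3))) =
      {1, Equiv.swap 0 1, Equiv.swap 0 2, Equiv.swap 1 2,
        Equiv.swap 0 1 * Equiv.swap 1 2, Equiv.swap 1 2 * Equiv.swap 0 1} := by decide
  rw [hu, Finset.sum_insert (by decide), Finset.sum_insert (by decide),
    Finset.sum_insert (by decide), Finset.sum_insert (by decide),
    Finset.sum_insert (by decide), Finset.sum_singleton] at h1
  have a1 : (Equiv.swap (0 : Fin 3) 1) 2 = 2 := by decide
  have a2 : (Equiv.swap (0 : Fin 3) 2) 1 = 1 := by decide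
  have a3 : (Equiv.swap (1 : Fin 3) 2) 0 = 0 := by decide
  simp [Equiv.Perm.sign_swap, a1, a2, a3] at h1
  simp only [map_sub, LinearMap.sub_apply]
  rw [← h1]
  abel
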